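/- Let N_z = (n_{z00}, n_{z01}, n_{z10}, n_{z11}) be independent Multinomial(n_z, q_z) for z in {0,1}, and given N_z = n_z for z in {0,1}, let (V_z*, V*_{z00}, V*_{z01}, V*_{z10}, V*_{z11}) be independent Dirichlet(1, n_z) for z in {0,1}. Let S_z be the random subset of the 3-dimensional probability simplex consisting of all q' with V*_{zay} ≤ q'_{ay} for all a,y in {0,1}. If the concatenated vector q = (q_0, q_1) lies in the interior of the complement of the feasibility set F, then the conditional probability P*((S_0 × S_1) ∩ F ≠ ∅), as a function of the observed counts, converges to 0 in probability as n_0, n_1 tend to infinity. -/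

import Mathlib

open MeasureTheory ProbabilityTheory Filter Matrix
open scoped ENNReal NNReal Topology

/-- The categorical distribution on a finite type. -/
noncomputable def categorical {ι : Type*} [Fintype ι] [MeasurableSpace ι] (q : ι → ℝ) :
    Measure ι := ∑ i : ι, ENNReal.ofReal (q i) • Measure.dirac i

/-- The multinomial distribution of category counts for `n` independent trials. -/
noncomputable def multinomial (ι : Type*) [Fintype ι] [DecidableEq ι] [MeasurableSpace ι]
    (n : ℕ) (q : ι → ℝ) : Measure (ι → ℕ) :=
  Measure.map (fun (x : Fin n → ι) (j : ι) => (Finset.univ.filter (fun i => x i = j)).card)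
    (Measure.pi fun _ : Fin n => categorical q)

/-- The Gamma distribution with shape `a` and rate `1`, with the convention
`Gamma(0, 1) = δ₀`. -/
noncomputable def gammaShape (a : ℝ) : Measure ℝ :=
  if a = 0 then Measure.dirac 0 else gammaMeasure a 1

/-- The Dirichlet distribution with shape vector `a`: the law of
`(X i / ∑ j, X j) i` for independent `X i ~ Gamma(a i, 1)`. -/
noncomputable def dirichlet {ι : Type*} [Fintype ι] (a : ι → ℝ) : Measure (ι → ℝ) :=
  Measure.map (fun x i => x i / ∑ j : ι, x j) (Measure.pi fun i : ι => gammaShape (a i))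

/-- The eight identities linking the counterfactual probabilities `p i j k l`
(`i = A₀, j = A₁, k = Y₀, l = Y₁`) to the observable probabilities
`q0 (a, y) = q_{0ay}` and `q1 (a, y) = q_{1ay}`. -/
def linkEqs (p : Fin 2 → Fin 2 → Fin 2 → Fin 2 → ℝ)
    (q0 q1 : Fin 2 × Fin 2 → ℝ) : Prop :=
  q0 (0, 0) = p 0 0 0 1 + p 0 0 0 0 + p 0 1 0 1 + p 0 1 0 0 ∧
  q0 (0, 1) = p 0 0 1 0 + p 0 0 1 1 + p 0 1 1 1 + p 0 1 1 0 ∧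
  q0 (1, 0) = p 1 1 1 0 + p 1 1 0 0 + p 1 0 1 0 + p 1 0 0 0 ∧
  q0 (1, 1) = p 1 1 0 1 + p 1 1 1 1 + p 1 0 1 1 + p 1 0 0 1 ∧
  q1 (0, 0) = p 0 0 0 1 + p 0 0 0 0 + p 1 0 0 1 + p 1 0 0 0 ∧
  q1 (0, 1) = p 0 0 1 0 + p 0 0 1 1 + p 1 0 1 1 + p 1 0 1 0 ∧
  q1 (1, 0) = p 1 1 1 0 + p 1 1 0 0 + p 0 1 1 0 + p 0 1 0 0 ∧
  q1 (1, 1) = p 1 1 0 1 + p 1 1 1 1 + p 0 1 1 1 + p 0 1 0 1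

/-- The feasibility set `F`: pairs of points of the 3-dimensional probability simplex for
which there exist nonnegative counterfactual probabilities `p i j k l` summing to `1`
satisfying the eight identities. -/
def Feas : Set (((Fin 2 × Fin 2) → ℝ) × ((Fin 2 × Fin 2) → ℝ)) :=
  {qq | qq.1 ∈ stdSimplex ℝ (Fin 2 × Fin 2) ∧ qq.2 ∈ stdSimplex ℝ (Fin 2 × Fin 2) ∧
    ∃ p : Fin 2 → Fin 2 → Fin 2 → Fin 2 → ℝ,
      (∀ i j k l, 0 ≤ p i j k l) ∧
      (∑ i : Fin 2, ∑ j : Fin 2, ∑ k : Fin 2, ∑ l : Fin 2, p i j k l) = 1 ∧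
      linkEqs p qq.1 qq.2}

/-- The Dirichlet shape vector `(1, c)` associated with a table of counts `c`. -/
def shapeOf (c : (Fin 2 × Fin 2) → ℕ) : Option (Fin 2 × Fin 2) → ℝ :=
  fun o => o.elim 1 (fun ay => (c ay : ℝ))

/-- The random polytope `S_z`: all points `q'` of the 3-dimensional probability simplex
with `V*_{zay} ≤ q'_{ay}` for all `a, y`. -/
def SzSet (v : Option (Fin 2 × Fin 2) → ℝ) : Set ((Fin 2 × Fin 2) → ℝ) :=
  {q' | q' ∈ stdSimplex ℝ (Fin 2 × Fin 2) ∧ ∀ ay : Fin 2 × Fin 2, v (some ay) ≤ q' ay}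

/-- The fiducial acceptance probability `P*((S₀ × S₁) ∩ F ≠ ∅)`: the probability, under
independent Dirichlet `(1, c0)` and `(1, c1)` fiducial randomness given the observed
counts `c0, c1`, that the random set `S₀ × S₁` meets the feasibility set `F`. -/
noncomputable def acceptProb (c0 c1 : (Fin 2 × Fin 2) → ℕ) : ℝ≥0∞ :=
  ((dirichlet (shapeOf c0)).prod (dirichlet (shapeOf c1)))
    {vv | ((SzSet vv.1 ×ˢ SzSet vv.2) ∩ Feas).Nonempty}

lemma gammaPDFReal_succ_aux {a : ℝ} (ha : 0 < a) (x : ℝ) :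
    a * gammaPDFReal (a + 1) 1 x = x * gammaPDFReal a 1 x := by
  unfold gammaPDFReal
  split_ifs with hx
  · have hG : Real.Gamma a ≠ 0 := (Real.Gamma_pos_of_pos ha).ne'
    have hp : x ^ (a + 1 - 1) = x ^ (a - 1) * x := by
      rcases hx.eq_or_lt with h | h
      · subst h
        simp [Real.zero_rpow ha.ne']
      · rw [← Real.rpow_add_one h.ne']
        congr 1
        ring
    rw [Real.Gamma_add_one ha.ne', hp, Real.one_rpow, Real.one_rpow]
    field_simp
  · simp

lemma lintegral_gamma_sq {a : ℝ} (ha : 0 < a) :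
    ∫⁻ x, ENNReal.ofReal ((x - a) ^ 2) ∂(gammaMeasure a 1) = ENNReal.ofReal a := by
  have hm : ∀ b : ℝ, Measurable (gammaPDF b 1) := fun b =>
    (measurable_gammaPDFReal b 1).ennreal_ofReal
  have hf : Measurable (fun x : ℝ => ENNReal.ofReal ((x - a) ^ 2)) := by fun_prop
  rw [gammaMeasure, lintegral_withDensity_eq_lintegral_mul _ (hm a) hf]
  have key : ∀ x, (gammaPDF a 1 * fun x : ℝ => ENNReal.ofReal ((x - a) ^ 2)) x
      + ENNReal.ofReal (2 * a ^ 2) * gammaPDF (a + 1) 1 x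
      = ENNReal.ofReal (a * (a + 1)) * gammaPDF (a + 1 + 1) 1 x
        + ENNReal.ofReal (a ^ 2) * gammaPDF a 1 x := by
    intro x
    have n0 := gammaPDFReal_nonneg ha one_pos x
    have n1 := gammaPDFReal_nonneg (a := a + 1) (by linarith) one_pos x
    have n2 := gammaPDFReal_nonneg (a := a + 1 + 1) (by linarith) one_pos x
    simp only [Pi.mul_apply, gammaPDF]
    rw [← ENNReal.ofReal_mul n0, ← ENNReal.ofReal_mul (by positivity),
      ← ENNReal.ofReal_mul (by positivity), ← ENNReal.ofReal_mul (by positivity),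
      ← ENNReal.ofReal_add (by positivity) (by positivity),
      ← ENNReal.ofReal_add (by positivity) (by positivity)]
    congr 1
    have e1 := gammaPDFReal_succ_aux ha x
    have e2 := gammaPDFReal_succ_aux (a := a + 1) (by linarith) x
    have e3 : a * ((a + 1) * gammaPDFReal (a + 1 + 1) 1 x) = x * (x * gammaPDFReal a 1 x) := by
      rw [e2, ← e1]; ring
    linear_combination 2 * a * e1 - e3
  have hI := lintegral_congr (μ := volume) key
  rw [lintegral_add_right _ ((hm _).const_mul _), lintegral_add_right _ ((hm _).const_mul _),
    lintegral_const_mul _ (hm _), lintegral_const_mul _ (hm _), lintegral_const_mul _ (hm _),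
    lintegral_gammaPDF_eq_one ha one_pos, lintegral_gammaPDF_eq_one (by linarith) one_pos,
    lintegral_gammaPDF_eq_one (by linarith) one_pos, mul_one, mul_one, mul_one,
    ← ENNReal.ofReal_add (by positivity) (by positivity)] at hI
  have h2 : ENNReal.ofReal (a * (a + 1) + a ^ 2)
      = ENNReal.ofReal a + ENNReal.ofReal (2 * a ^ 2) := by
    rw [← ENNReal.ofReal_add (by positivity) (by positivity)]
    congr 1
    ring
  rw [h2] at hI
  exact (ENNReal.add_left_inj ENNReal.ofReal_ne_top).1 hI

lemma isProbabilityMeasure_gammaShape {a : ℝ} (ha : 0 ≤ a) :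
    IsProbabilityMeasure (gammaShape a) := by
  unfold gammaShape
  split_ifs with h
  · infer_instance
  · exact isProbabilityMeasure_gammaMeasure (lt_of_le_of_ne ha (Ne.symm h)) one_pos

lemma gammaShape_cheb {a t : ℝ} (ha : 0 ≤ a) (ht : 0 < t) :
    gammaShape a {x | t < |x - a|} ≤ ENNReal.ofReal (a / t ^ 2) := by
  unfold gammaShape
  split_ifs with h
  · subst h
    rw [Measure.dirac_apply' _ (measurableSet_lt measurable_const (by fun_prop))]
    simp [ht.le]
  · have ha' : 0 < a := lt_of_le_of_ne ha (Ne.symm h)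
    have hf : Measurable (fun x : ℝ => ENNReal.ofReal ((x - a) ^ 2)) := by fun_prop
    have := mul_meas_ge_le_lintegral (μ := gammaMeasure a 1) hf (ENNReal.ofReal (t ^ 2))
    rw [lintegral_gamma_sq ha'] at this
    rw [ENNReal.ofReal_div_of_pos (by positivity)]
    rw [ENNReal.le_div_iff_mul_le (Or.inl (by simp; positivity)) (Or.inl ENNReal.ofReal_ne_top),
      mul_comm]
    refine le_trans (mul_le_mul_right (measure_mono ?_) _) this
    intro x hx
    simp only [Set.mem_ofPred_eq] at hx ⊢
    apply ENNReal.ofReal_le_ofReal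
    rw [← sq_abs (x - a)]
    exact pow_le_pow_left₀ ht.le hx.le 2

lemma pi_gamma_cheb {ι : Type*} [Fintype ι] (a : ι → ℝ) (ha : ∀ i, 0 ≤ a i) {t : ℝ}
    (ht : 0 < t) :
    (Measure.pi fun i => gammaShape (a i)) {x | ∃ i, t < |x i - a i|}
      ≤ ENNReal.ofReal ((∑ i, a i) / t ^ 2) := by
  have : ∀ i, IsProbabilityMeasure (gammaShape (a i)) :=
    fun i => isProbabilityMeasure_gammaShape (ha i)
  have hU : {x : ι → ℝ | ∃ i, t < |x i - a i|} = ⋃ i, {x : ι → ℝ | t < |x i - a i|} := by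
    ext; simp
  rw [hU, Finset.sum_div, ENNReal.ofReal_sum_of_nonneg (fun i _ => div_nonneg (ha i) (sq_nonneg t))]
  refine (measure_iUnion_fintype_le _ _).trans (Finset.sum_le_sum fun i _ => ?_)
  have hms : MeasurableSet {y : ℝ | t < |y - a i|} :=
    measurableSet_lt measurable_const (by fun_prop)
  have := (measurePreserving_eval (fun i => gammaShape (a i)) i).measure_preimage
    hms.nullMeasurableSet
  exact this.le.trans (gammaShape_cheb (ha i) ht)

lemma dirichlet_lower (c : Fin 2 × Fin 2 → ℕ) (q : Fin 2 × Fin 2 → ℝ)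
    (hq : q ∈ stdSimplex ℝ (Fin 2 × Fin 2)) (n : ℕ) (hc : ∑ j, c j = n) {δ : ℝ} (hδ : 0 < δ)
    (hδ1 : δ ≤ 1) (hn : 1 ≤ δ / 8 * n) (hcq : ∀ j, (q j - δ / 8) * n ≤ c j) :
    dirichlet (shapeOf c) {v | ∃ j, v (some j) < q j - δ}
      ≤ ENNReal.ofReal ((n + 1) / (δ / 8 * n) ^ 2) := by
  have ha : ∀ o, 0 ≤ shapeOf c o := by
    intro o
    cases o <;> simp [shapeOf]
  have hsum : ∑ o, shapeOf c o = n + 1 := by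
    rw [Fintype.sum_option, ← hc]
    simp [shapeOf, add_comm]
  unfold dirichlet
  have hmap : Measurable (fun (x : Option (Fin 2 × Fin 2) → ℝ) i => x i / ∑ j, x j) := by
    fun_prop
  have hms : MeasurableSet
      {v : Option (Fin 2 × Fin 2) → ℝ | ∃ j, v (some j) < q j - δ} := by
    rw [Set.ofPred_exists]
    exact MeasurableSet.iUnion fun j => measurableSet_lt (by fun_prop) (by fun_prop)
  rw [Measure.map_apply hmap hms]
  have ht : 0 < δ / 8 * n := by linarith
  refine le_trans (measure_mono ?_) ((pi_gamma_cheb (shapeOf c) ha ht).trans_eq (by rw [hsum]))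
  rintro x ⟨j, hj⟩
  simp only [Set.mem_ofPred_eq]
  by_contra! hcon
  have hS : |∑ o, x o - (n + 1)| ≤ 5 * (δ / 8 * n) := by
    rw [← hsum, ← Finset.sum_sub_distrib]
    refine (Finset.abs_sum_le_sum_abs _ _).trans ((Finset.sum_le_sum fun o _ => hcon o).trans ?_)
    simp
  obtain ⟨hS1, hS2⟩ := abs_le.1 hS
  have hn0 : (0 : ℝ) < n := by
    by_contra! h
    nlinarith
  have hxj := (abs_le.1 (hcon (some j))).1
  have hcj := hcq j
  have hsj : shapeOf c (some j) = c j := rfl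
  rw [hsj] at hxj
  have hq1 : q j ≤ 1 := by
    rw [← hq.2]
    exact Finset.single_le_sum (fun i _ => hq.1 i) (Finset.mem_univ j)
  have hq0 : 0 ≤ q j := hq.1 j
  have hδn : δ * n ≤ n := by nlinarith
  have hSpos : 0 < ∑ o, x o := by nlinarith
  have hj' : x (some j) / ∑ o, x o < q j - δ := hj
  rw [div_lt_iff₀ hSpos] at hj'
  have hxl : (q j - δ / 4) * n ≤ x (some j) := by nlinarith
  rcases le_or_gt 0 (q j - δ) with h | h
  · have h1 : (q j - δ) * ∑ o, x o ≤ (q j - δ) * (n * (1 + 6 * (δ / 8))) :=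
      mul_le_mul_of_nonneg_left (by linarith) h
    have h2 : (q j - δ) * (1 + 6 * (δ / 8)) ≤ q j - δ / 4 := by nlinarith
    have h3 := mul_le_mul_of_nonneg_right h2 hn0.le
    linarith
  · have h1 : (q j - δ) * ∑ o, x o ≤ (q j - δ) * (n * (1 - 5 * (δ / 8))) :=
      mul_le_mul_of_nonpos_left (by linarith) h.le
    have h2 : (q j - δ) * (1 - 5 * (δ / 8)) ≤ q j - δ / 4 := by nlinarith
    have h3 := mul_le_mul_of_nonneg_right h2 hn0.le
    linarith

lemma isProb_categorical (q : Fin 2 × Fin 2 → ℝ) (hq : q ∈ stdSimplex ℝ (Fin 2 × Fin 2)) :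
    IsProbabilityMeasure (categorical q) := by
  constructor
  simp only [categorical, Measure.coe_finsetSum, Finset.sum_apply, Measure.smul_apply,
    measure_univ, smul_eq_mul, mul_one]
  rw [← ENNReal.ofReal_sum_of_nonneg (fun i _ => hq.1 i), hq.2, ENNReal.ofReal_one]

lemma integral_categorical (q : Fin 2 × Fin 2 → ℝ) (hq : q ∈ stdSimplex ℝ (Fin 2 × Fin 2))
    (j : Fin 2 × Fin 2) :
    ∫ y, (if y = j then (1 : ℝ) else 0) ∂(categorical q) = q j := by
  have := isProb_categorical q hq
  rw [integral_fintype (by exact Integrable.of_finite)]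
  have : ∀ y, (categorical q).real {y} = q y := by
    intro y
    simp only [Measure.real, categorical, Measure.coe_finsetSum, Finset.sum_apply,
      Measure.smul_apply, smul_eq_mul]
    rw [Finset.sum_eq_single y]
    · simp [hq.1 y]
    · intro b _ hb
      simp [hb]
    · simp
  simp [this]

lemma multinomial_cheb (q : Fin 2 × Fin 2 → ℝ) (hq : q ∈ stdSimplex ℝ (Fin 2 × Fin 2)) (n : ℕ)
    {η : ℝ} (hη : 0 < η) (hn : 0 < n) :
    multinomial (Fin 2 × Fin 2) n q {c | ¬ (∑ j, c j = n ∧ ∀ j, (q j - η) * n ≤ c j)}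
      ≤ ENNReal.ofReal (1 / (η ^ 2 * n)) := by
  have := isProb_categorical q hq
  have hn' : (0 : ℝ) < n := by exact_mod_cast hn
  set X : Fin 2 × Fin 2 → Fin 2 × Fin 2 → ℝ := fun j y => if y = j then 1 else 0 with hX
  set P := Measure.pi fun _ : Fin n => categorical q with hP
  have hL : ∀ j, MemLp (X j) 2 (categorical q) := fun j => MemLp.of_discrete
  have hcheb : ∀ j, P {x | η * n ≤ |(∑ i : Fin n, fun x : Fin n → Fin 2 × Fin 2 => X j (x i)) x
      - n * q j|} ≤ ENNReal.ofReal (1 / 4 / (η ^ 2 * n)) := by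
    intro j
    have hmean : P[∑ i : Fin n, fun x : Fin n → Fin 2 × Fin 2 => X j (x i)] = n * q j := by
      simp only [Finset.sum_apply]
      rw [integral_finsetSum _ (fun i _ => Integrable.of_finite)]
      have : ∀ i : Fin n, ∫ x, X j (x i) ∂P = q j := by
        intro i
        rw [← integral_categorical q hq j]
        have := (measurePreserving_eval (fun _ : Fin n => categorical q) i)
        rw [← this.map_eq, integral_map this.measurable.aemeasurable
          (by fun_prop)]
      simp [this]
    have hvar : Var[∑ i : Fin n, fun x : Fin n → Fin 2 × Fin 2 => X j (x i); P] ≤ n * (1 / 4) := by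
      rw [hP, variance_sum_pi (fun _ => hL j)]
      have : Var[X j; categorical q] ≤ 1 / 4 := by
        refine (variance_le_sq_of_bounded (a := 0) (b := 1) (ae_of_all _ fun y => ?_)
          (by fun_prop)).trans_eq (by norm_num)
        simp only [hX]
        split_ifs <;> simp
      calc _ ≤ ∑ i : Fin n, (1 / 4 : ℝ) := Finset.sum_le_sum fun i _ => this
        _ = _ := by simp
    have := meas_ge_le_variance_div_sq (μ := P)
      (X := ∑ i : Fin n, fun x : Fin n → Fin 2 × Fin 2 => X j (x i))
      MemLp.of_discrete (c := η * n) (by positivity)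
    rw [hmean] at this
    refine this.trans (ENNReal.ofReal_le_ofReal ?_)
    rw [div_le_div_iff₀ (by positivity) (by positivity)]
    calc _ ≤ n * (1 / 4) * (η ^ 2 * n) := mul_le_mul_of_nonneg_right hvar (by positivity)
      _ = _ := by ring
  unfold multinomial
  rw [Measure.map_apply (measurable_of_countable _) (Set.to_countable _).measurableSet]
  calc _ ≤ P (⋃ j, {x | η * n ≤ |(∑ i : Fin n, fun x : Fin n → Fin 2 × Fin 2 => X j (x i)) x
      - n * q j|}) := by
        refine measure_mono ?_
        intro x hx
        simp only [Set.mem_preimage, Set.mem_ofPred_eq] at hx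
        have h1 : ∑ j, (Finset.univ.filter (fun i => x i = j)).card = n := by
          have := Finset.card_eq_sum_card_fiberwise (f := x) (s := Finset.univ)
            (t := Finset.univ) (by simp)
          simpa using this.symm
        have h2 : ∃ j, ((Finset.univ.filter (fun i => x i = j)).card : ℝ) < (q j - η) * n := by
          by_contra! h
          exact hx ⟨h1, h⟩
        obtain ⟨j, hj⟩ := h2
        simp only [Set.mem_iUnion, Set.mem_ofPred_eq]
        refine ⟨j, ?_⟩
        have h3 : (∑ i : Fin n, fun x : Fin n → Fin 2 × Fin 2 => X j (x i)) x
            = ((Finset.univ.filter (fun i => x i = j)).card : ℝ) := by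
          simp [hX]
        rw [h3, abs_sub_comm]
        refine le_trans ?_ (le_abs_self _)
        linarith
    _ ≤ ∑ j : Fin 2 × Fin 2, ENNReal.ofReal (1 / 4 / (η ^ 2 * n)) :=
        (measure_iUnion_fintype_le _ _).trans (Finset.sum_le_sum fun j _ => hcheb j)
    _ = _ := by
        rw [← ENNReal.ofReal_sum_of_nonneg (fun i _ => by positivity)]
        congr 1
        simp
        ring

lemma simplex_close {ι : Type*} [Fintype ι] (q q' : ι → ℝ)
    (hq : q ∈ stdSimplex ℝ ι) (hq' : q' ∈ stdSimplex ℝ ι) {δ : ℝ} (hδ : 0 ≤ δ)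
    (h : ∀ j, q j - δ ≤ q' j) : dist q' q ≤ Fintype.card ι * δ := by
  have hcard : 0 ≤ Fintype.card ι * δ := by positivity
  rw [dist_pi_le_iff hcard]
  intro j
  have h0 : ∑ i, (q' i - q i + δ) = Fintype.card ι * δ := by
    rw [Finset.sum_add_distrib, Finset.sum_sub_distrib, hq.2, hq'.2]
    simp
  have h1 : q' j - q j + δ ≤ ∑ i, (q' i - q i + δ) :=
    Finset.single_le_sum (f := fun i => q' i - q i + δ) (fun i _ => by linarith [h i])
      (Finset.mem_univ j)
  have h2 : δ ≤ Fintype.card ι * δ := by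
    have : (1 : ℝ) ≤ Fintype.card ι := by
      exact_mod_cast Fintype.card_pos_iff.2 ⟨j⟩
    nlinarith
  rw [Real.dist_eq, abs_le]
  constructor <;> linarith [h j]

lemma isProb_dirichlet {ι : Type*} [Fintype ι] (a : ι → ℝ) (ha : ∀ i, 0 ≤ a i) :
    IsProbabilityMeasure (dirichlet a) := by
  have : ∀ i, IsProbabilityMeasure (gammaShape (a i)) :=
    fun i => isProbabilityMeasure_gammaShape (ha i)
  unfold dirichlet
  exact Measure.isProbabilityMeasure_map (by fun_prop)

lemma isProb_multinomial (q : Fin 2 × Fin 2 → ℝ) (hq : q ∈ stdSimplex ℝ (Fin 2 × Fin 2)) (n : ℕ) :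
    IsProbabilityMeasure (multinomial (Fin 2 × Fin 2) n q) := by
  have := isProb_categorical q hq
  unfold multinomial
  exact Measure.isProbabilityMeasure_map (measurable_of_countable _).aemeasurable

lemma prod_union_le {α β : Type*} [MeasurableSpace α] [MeasurableSpace β] (μ : Measure α)
    (ν : Measure β) [IsProbabilityMeasure μ] [IsProbabilityMeasure ν] (A : Set α) (B : Set β)
    (S : Set (α × β)) (hS : ∀ p ∈ S, p.1 ∈ A ∨ p.2 ∈ B) :
    (μ.prod ν) S ≤ μ A + ν B := by
  have : S ⊆ A ×ˢ Set.univ ∪ Set.univ ×ˢ B := by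
    intro p hp
    rcases hS p hp with h | h <;> simp [h]
  refine (measure_mono this).trans ((measure_union_le _ _).trans ?_)
  simp [Measure.prod_prod]

lemma shapeOf_nonneg (c : Fin 2 × Fin 2 → ℕ) (o) : 0 ≤ shapeOf c o := by
  cases o <;> simp [shapeOf]

lemma tendsto_bound1 {η : ℝ} (hη : 0 < η) {m : ℕ → ℕ} (hm : Tendsto m atTop atTop) :
    Tendsto (fun k => ((m k : ℝ) + 1) / (η * m k) ^ 2) atTop (𝓝 0) := by
  have hr : Tendsto (fun k => ((m k : ℝ))⁻¹) atTop (𝓝 0) :=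
    tendsto_inv_atTop_zero.comp (tendsto_natCast_atTop_atTop.comp hm)
  have h : Tendsto (fun k => (((m k : ℝ))⁻¹ + ((m k : ℝ))⁻¹ * ((m k : ℝ))⁻¹) / η ^ 2) atTop
      (𝓝 ((0 + 0 * 0) / η ^ 2)) := (hr.add (hr.mul hr)).div_const _
  simp only [mul_zero, add_zero, zero_div] at h
  refine h.congr' ?_
  filter_upwards [hm.eventually_gt_atTop 0] with k hk
  have : (m k : ℝ) ≠ 0 := by exact_mod_cast hk.ne'
  field_simp

lemma tendsto_bound2 {η : ℝ} {m : ℕ → ℕ} (hm : Tendsto m atTop atTop) :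
    Tendsto (fun k => ENNReal.ofReal (1 / (η ^ 2 * (m k : ℝ)))) atTop (𝓝 0) := by
  have hr : Tendsto (fun k => ((m k : ℝ))⁻¹) atTop (𝓝 0) :=
    tendsto_inv_atTop_zero.comp (tendsto_natCast_atTop_atTop.comp hm)
  have h := (hr.const_mul ((η ^ 2)⁻¹))
  rw [mul_zero] at h
  rw [← ENNReal.ofReal_zero]
  refine (ENNReal.continuous_ofReal.tendsto _).comp (h.congr fun k => ?_)
  rw [one_div, mul_inv]

/-- **Theorem 1, part 2 (acceptance probability under infeasibility).**
Let `N_z ~ Multinomial(n_z, q_z)` be independent for `z ∈ {0,1}` and, given the counts,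
let the fiducial randomness be independent `Dirichlet(1, N_z)`.  If `q = (q₀, q₁)` lies in
the interior of the complement of the feasibility set `F` (relative to the product of
simplices), then the conditional probability `P*((S₀ × S₁) ∩ F ≠ ∅)` converges to `0` in
probability as `n₀, n₁ → ∞`. -/
theorem acceptProb_tendsto_zero
    (q0 q1 : (Fin 2 × Fin 2) → ℝ)
    (hq0 : q0 ∈ stdSimplex ℝ (Fin 2 × Fin 2)) (hq1 : q1 ∈ stdSimplex ℝ (Fin 2 × Fin 2))
    -- `(q0, q1)` lies in the interior of `Fᶜ` relative to the product of simplices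
    (hint : ∃ U : Set (((Fin 2 × Fin 2) → ℝ) × ((Fin 2 × Fin 2) → ℝ)),
      IsOpen U ∧ (q0, q1) ∈ U ∧ U ∩ Feas = ∅)
    (n0 n1 : ℕ → ℕ)
    (hn0 : Tendsto n0 atTop atTop) (hn1 : Tendsto n1 atTop atTop) :
    ∀ ε : ℝ, 0 < ε →
      Tendsto
        (fun n : ℕ =>
          ((multinomial (Fin 2 × Fin 2) (n0 n) q0).prod
            (multinomial (Fin 2 × Fin 2) (n1 n) q1))
            {cc | ε ≤ (acceptProb cc.1 cc.2).toReal})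
        atTop (𝓝 0) := by
  intro ε hε
  obtain ⟨U, hUo, hqU, hUF⟩ := hint
  obtain ⟨r, hr, hball⟩ := Metric.isOpen_iff.1 hUo _ hqU
  obtain ⟨δ, hδ, hδ1, hδr⟩ : ∃ δ : ℝ, 0 < δ ∧ δ ≤ 1 ∧ 4 * δ < r :=
    ⟨min 1 (r / 8), by positivity, min_le_left _ _, by linarith [min_le_right 1 (r / 8)]⟩
  have hη : 0 < δ / 8 := by positivity
  have hacc : ∀ c0 c1, acceptProb c0 c1
      ≤ dirichlet (shapeOf c0) {v | ∃ j, v (some j) < q0 j - δ}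
        + dirichlet (shapeOf c1) {v | ∃ j, v (some j) < q1 j - δ} := by
    intro c0 c1
    have := isProb_dirichlet _ (shapeOf_nonneg c0)
    have := isProb_dirichlet _ (shapeOf_nonneg c1)
    refine prod_union_le _ _ _ _ _ ?_
    rintro ⟨v0, v1⟩ ⟨⟨p0, p1⟩, ⟨⟨hp0, hv0⟩, ⟨hp1, hv1⟩⟩, hF⟩
    by_contra! hcon
    simp only [Set.mem_ofPred_eq, not_exists, not_lt] at hcon
    have d0 := simplex_close q0 p0 hq0 hp0 hδ.le fun j => (hcon.1 j).trans (hv0 j)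
    have d1 := simplex_close q1 p1 hq1 hp1 hδ.le fun j => (hcon.2 j).trans (hv1 j)
    have hc4 : ((Fintype.card (Fin 2 × Fin 2) : ℕ) : ℝ) = 4 := by norm_num
    rw [hc4] at d0 d1
    have hmem : (p0, p1) ∈ U := by
      apply hball
      rw [Metric.mem_ball, Prod.dist_eq]
      exact max_lt (by linarith) (by linarith)
    have : (p0, p1) ∈ U ∩ Feas := ⟨hmem, hF⟩
    rw [hUF] at this
    exact this
  have hbig : ∀ m : ℕ → ℕ, Tendsto m atTop atTop →
      ∀ᶠ k in atTop, 1 ≤ δ / 8 * (m k : ℝ) := fun m hm =>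
    ((tendsto_natCast_atTop_atTop.comp hm).const_mul_atTop hη).eventually_ge_atTop 1
  have hsm : ∀ m : ℕ → ℕ, Tendsto m atTop atTop →
      ∀ᶠ k in atTop, ((m k : ℝ) + 1) / (δ / 8 * m k) ^ 2 < ε / 2 := fun m hm =>
    (tendsto_bound1 hη hm).eventually_lt_const (by positivity)
  have hlim := (tendsto_bound2 (η := δ / 8) hn0).add (tendsto_bound2 (η := δ / 8) hn1)
  rw [add_zero] at hlim
  refine tendsto_of_tendsto_of_tendsto_of_le_of_le' tendsto_const_nhds hlim
    (Eventually.of_forall fun _ => zero_le) ?_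
  filter_upwards [hbig n0 hn0, hbig n1 hn1, hsm n0 hn0, hsm n1 hn1,
    hn0.eventually_gt_atTop 0, hn1.eventually_gt_atTop 0] with k b0 b1 s0 s1 g0 g1
  have := isProb_multinomial q0 hq0 (n0 k)
  have := isProb_multinomial q1 hq1 (n1 k)
  refine (prod_union_le _ _
    {c | ¬ (∑ j, c j = n0 k ∧ ∀ j, (q0 j - δ / 8) * n0 k ≤ c j)}
    {c | ¬ (∑ j, c j = n1 k ∧ ∀ j, (q1 j - δ / 8) * n1 k ≤ c j)} _ ?_).trans
    (add_le_add (multinomial_cheb q0 hq0 _ hη g0) (multinomial_cheb q1 hq1 _ hη g1))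
  rintro ⟨c0, c1⟩ hc
  by_contra hcon
  simp only [Set.mem_ofPred_eq, not_or, not_not] at hcon hc
  obtain ⟨⟨e0, l0⟩, e1, l1⟩ := hcon
  have h0 := dirichlet_lower c0 q0 hq0 _ e0 hδ hδ1 b0 l0
  have h1 := dirichlet_lower c1 q1 hq1 _ e1 hδ hδ1 b1 l1
  have h2 := (hacc c0 c1).trans (add_le_add h0 h1)
  rw [← ENNReal.ofReal_add (by positivity) (by positivity)] at h2
  have h3 := ENNReal.toReal_mono ENNReal.ofReal_ne_top h2
  rw [ENNReal.toReal_ofReal (by positivity)] at h3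
  linarith
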